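/- (Second moment of the estimation value.) For every ε > 0 and every n ∈ ℕ, Σ_{l ∈ ℕ} Q_l(n)·A_ε(l)² = (1 + ε²)·n². -/

import Mathlib

/-- The optimal estimation function `A_ε(l) = ((1+2ε²)^l − 1)(1+ε²)/(2ε²)`. -/
noncomputable def A (ε : ℝ) (l : ℕ) : ℝ :=
  ((1 + 2 * ε ^ 2) ^ l - 1) / (2 * ε ^ 2) * (1 + ε ^ 2)

/-- `D_ε(l) = A_ε(l+1) − A_ε(l)`. -/
noncomputable def D (ε : ℝ) (l : ℕ) : ℝ := A ε (l + 1) - A ε l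

/-- `Q ε n l` is the probability `Q_l(n)` that the counter's symbol equals `l`
after `n` packet arrivals, for the process that starts at symbol `0` and on
each arrival increments the current symbol `l` to `l+1` with probability
`1/D_ε(l)`. -/
noncomputable def Q (ε : ℝ) : ℕ → ℕ → ℝ
  | 0, 0 => 1
  | 0, _ + 1 => 0
  | n + 1, 0 => Q ε n 0 * (1 - 1 / D ε 0)
  | n + 1, l + 1 => Q ε n (l + 1) * (1 - 1 / D ε (l + 1)) + Q ε n l / D ε l

lemma Q_eq_zero_of_lt (ε : ℝ) {n l : ℕ} (h : n < l) : Q ε n l = 0 := by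
  induction n generalizing l with
  | zero =>
    obtain ⟨m, rfl⟩ := Nat.exists_eq_succ_of_ne_zero h.ne'
    simp [Q]
  | succ n ih =>
    obtain ⟨m, rfl⟩ := Nat.exists_eq_succ_of_ne_zero (Nat.ne_zero_of_lt h)
    simp [Q, ih (show n < m + 1 by omega), ih (show n < m by omega)]

/-- One step of the counter changes the expectation of `f` by the expectation of its drift. -/
lemma sum_Q_succ_mul (ε : ℝ) (f : ℕ → ℝ) (n : ℕ) :
    ∑ l ∈ Finset.range (n + 2), Q ε (n + 1) l * f l =
      ∑ l ∈ Finset.range (n + 1), Q ε n l * (f l + (f (l + 1) - f l) / D ε l) := by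
  have h : ∑ l ∈ Finset.range (n + 1), Q ε n l * (1 - 1 / D ε l) * f l =
      ∑ l ∈ Finset.range (n + 1), Q ε n (l + 1) * (1 - 1 / D ε (l + 1)) * f (l + 1) +
        Q ε n 0 * (1 - 1 / D ε 0) * f 0 := by
    rw [← Finset.sum_range_succ' (fun l => Q ε n l * (1 - 1 / D ε l) * f l),
      Finset.sum_range_succ _ (n + 1), Q_eq_zero_of_lt ε (Nat.lt_succ_self n)]
    simp
  calc ∑ l ∈ Finset.range (n + 2), Q ε (n + 1) l * f l
      = ∑ l ∈ Finset.range (n + 1), Q ε n l * (1 - 1 / D ε l) * f l +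
          ∑ l ∈ Finset.range (n + 1), Q ε n l / D ε l * f (l + 1) := by
        rw [h, Finset.sum_range_succ']
        simp only [Q, add_mul, Finset.sum_add_distrib]
        ring
    _ = _ := by
        rw [← Finset.sum_add_distrib]
        exact Finset.sum_congr rfl fun l _ => by ring

lemma D_eq {ε : ℝ} (hε : 0 < ε) (l : ℕ) : D ε l = (1 + 2 * ε ^ 2) ^ l * (1 + ε ^ 2) := by
  unfold D A
  field_simp
  ring

lemma D_pos {ε : ℝ} (hε : 0 < ε) (l : ℕ) : 0 < D ε l := by
  rw [D_eq hε]
  positivity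

lemma D_eq_A {ε : ℝ} (hε : 0 < ε) (l : ℕ) : D ε l = 2 * ε ^ 2 * A ε l + (1 + ε ^ 2) := by
  rw [D_eq hε, A]
  field_simp
  ring

lemma sum_Q (ε : ℝ) (n : ℕ) : ∑ l ∈ Finset.range (n + 1), Q ε n l = 1 := by
  induction n with
  | zero => simp [Q]
  | succ n ih => simpa [ih] using sum_Q_succ_mul ε (fun _ => 1) n

lemma sum_Q_mul_A {ε : ℝ} (hε : 0 < ε) (n : ℕ) :
    ∑ l ∈ Finset.range (n + 1), Q ε n l * A ε l = n := by
  induction n with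
  | zero => simp [Q, A]
  | succ n ih =>
    have h (l : ℕ) : (A ε (l + 1) - A ε l) / D ε l = 1 := div_self (D_pos hε l).ne'
    simp only [sum_Q_succ_mul, h, mul_add, mul_one, Finset.sum_add_distrib, ih, sum_Q]
    push_cast
    ring

lemma sq_A_drift {ε : ℝ} (hε : 0 < ε) (l : ℕ) :
    (A ε (l + 1) ^ 2 - A ε l ^ 2) / D ε l = 2 * (1 + ε ^ 2) * A ε l + (1 + ε ^ 2) := by
  have h : A ε (l + 1) = A ε l + D ε l := by simp [D]
  rw [div_eq_iff (D_pos hε l).ne', h]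
  linear_combination D ε l * D_eq_A hε l

lemma sum_Q_mul_sq_A {ε : ℝ} (hε : 0 < ε) (n : ℕ) :
    ∑ l ∈ Finset.range (n + 1), Q ε n l * A ε l ^ 2 = (1 + ε ^ 2) * (n : ℝ) ^ 2 := by
  induction n with
  | zero => simp [Q, A]
  | succ n ih =>
    calc ∑ l ∈ Finset.range (n + 2), Q ε (n + 1) l * A ε l ^ 2
        = ∑ l ∈ Finset.range (n + 1), (Q ε n l * A ε l ^ 2 +
            2 * (1 + ε ^ 2) * (Q ε n l * A ε l) + (1 + ε ^ 2) * Q ε n l) := by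
          rw [sum_Q_succ_mul ε (fun l => A ε l ^ 2)]
          exact Finset.sum_congr rfl fun l _ => by rw [sq_A_drift hε]; ring
      _ = _ := by
          rw [Finset.sum_add_distrib, Finset.sum_add_distrib, ← Finset.mul_sum, ← Finset.mul_sum,
            ih, sum_Q_mul_A hε, sum_Q]
          push_cast
          ring

/-- Second moment of the estimation value: for every `ε > 0`
and `n`, `Σ_l Q_l(n)·A_ε(l)² = (1 + ε²)·n²`. -/
theorem second_moment (ε : ℝ) (hε : ε > 0) (n : ℕ) :
    (∑' l : ℕ, Q ε n l * (A ε l) ^ 2) = (1 + ε ^ 2) * (n : ℝ) ^ 2 := by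
  rw [← sum_Q_mul_sq_A hε n]
  refine tsum_eq_sum fun l hl => ?_
  rw [Q_eq_zero_of_lt ε (by rw [Finset.mem_range] at hl; omega), zero_mul]
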